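/- Let R > 0 and z₀ < −R be fixed. There exist a number λ₀ > 1 and a constant C > 0, both depending only on R and z₀, such that for every λ ≥ λ₀ and every w ∈ C²([−R, R]; ℝ), setting y(z) = e^{λ(z−z₀)^{−2}} w(z), one has ∫_{−R}^{R} e^{2λ(z−z₀)^{−2}} |w''(z)|² dz ≥ −C (λ³ |y(R)|² + λ |y'(R)|²) − C (λ³ |y(−R)|² + λ |y'(−R)|²) + C λ³ ∫_{−R}^{R} |y(z)|² dz − C λ ∫_{−R}^{R} |y'(z)|² dz. -/

import Mathlib

lemma carl_hasDeriv (c z₀ z : ℝ) (hz : 0 < z - z₀) :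
    HasDerivAt (fun z => Real.exp (c / (z - z₀) ^ 2))
      (Real.exp (c / (z - z₀) ^ 2) * (-(2 * c) / (z - z₀) ^ 3)) z := by
  have h1 : HasDerivAt (fun z : ℝ => (z - z₀) ^ 2) (2 * (z - z₀)) z := by
    simpa using ((hasDerivAt_id z).sub_const z₀).fun_pow 2
  have h2 := ((hasDerivAt_const z c).div h1 (by positivity)).exp
  convert h2 using 1
  simp only [Pi.div_apply]
  congr 1
  field_simp
  ring

lemma carl_step (R z₀ lam k : ℝ) (hR : 0 < R) (hz₀ : z₀ < -R) (hl : 0 < lam) (hk : 0 < k)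
    (hk2 : k = 2 / (R - z₀) ^ 3) (u u' : ℝ → ℝ)
    (hu : ∀ z ∈ Set.Icc (-R) R, HasDerivWithinAt u (u' z) (Set.Icc (-R) R) z)
    (hu' : ContinuousOn u' (Set.Icc (-R) R)) :
    (k * lam) ^ 2 * (∫ z in (-R)..R, Real.exp (2 * lam / (z - z₀) ^ 2) * (u z) ^ 2)
      - k * lam * (Real.exp (2 * lam / (-R - z₀) ^ 2) * (u (-R)) ^ 2)
      ≤ ∫ z in (-R)..R, Real.exp (2 * lam / (z - z₀) ^ 2) * (u' z) ^ 2 := by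
  have hab : -R ≤ R := by linarith
  have hpos : ∀ z ∈ Set.Icc (-R) R, 0 < z - z₀ := fun z hz => by linarith [hz.1]
  have huc : ContinuousOn u (Set.Icc (-R) R) := fun z hz => (hu z hz).continuousWithinAt
  have hE : ContinuousOn (fun z => Real.exp (2 * lam / (z - z₀) ^ 2)) (Set.Icc (-R) R) :=
    fun z hz => (carl_hasDeriv (2 * lam) z₀ z (hpos z hz)).continuousAt.continuousWithinAt
  have hc1 := hE.mul (huc.pow 2)
  have hc2 := hE.mul (hu'.pow 2)
  have hi1 := hc1.intervalIntegrable_of_Icc (μ := MeasureTheory.volume) hab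
  have hi2 := hc2.intervalIntegrable_of_Icc (μ := MeasureTheory.volume) hab
  have key := intervalIntegral.sub_le_integral_of_hasDeriv_right_of_le hab
    (g := fun z => k * lam * (Real.exp (2 * lam / (z - z₀) ^ 2) * (u z) ^ 2))
    (g' := fun z => k * lam * (Real.exp (2 * lam / (z - z₀) ^ 2) * (-(2 * (2 * lam)) / (z - z₀) ^ 3)
      * (u z) ^ 2 + Real.exp (2 * lam / (z - z₀) ^ 2) * (2 * u z * u' z)))
    (φ := fun z => Real.exp (2 * lam / (z - z₀) ^ 2) * (u' z) ^ 2
      - (k * lam) ^ 2 * (Real.exp (2 * lam / (z - z₀) ^ 2) * (u z) ^ 2))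
    (continuousOn_const.mul hc1)
    (by
      intro z hz
      have hz' := Set.Ioo_subset_Icc_self hz
      have h1 : HasDerivAt u (u' z) z := (hu z hz').hasDerivAt (Icc_mem_nhds hz.1 hz.2)
      have h2 : HasDerivAt (fun z => (u z) ^ 2) (2 * u z * u' z) z := by
        simpa using h1.fun_pow 2
      exact (((carl_hasDeriv (2 * lam) z₀ z (hpos z hz')).mul h2).const_mul _).hasDerivWithinAt)
    (by
      exact ((hc2.sub (continuousOn_const.mul hc1)).integrableOn_Icc))
    (by
      intro z hz
      have hz' := Set.Ioo_subset_Icc_self hz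
      have hs := hpos z hz'
      have hB : z - z₀ ≤ R - z₀ := by linarith [hz.2]
      have hkp : k ≤ 2 / (z - z₀) ^ 3 := by rw [hk2]; gcongr
      have hrw : -(2 * (2 * lam)) / (z - z₀) ^ 3 = -2 * lam * (2 / (z - z₀) ^ 3) := by ring
      simp only [hrw]
      generalize 2 / (z - z₀) ^ 3 = p at *
      have he := Real.exp_pos (2 * lam / (z - z₀) ^ 2)
      generalize Real.exp (2 * lam / (z - z₀) ^ 2) = E at *
      have h3 : 0 ≤ E * ((u' z - k * lam * u z) ^ 2 + 2 * (k * lam ^ 2) * (p - k) * (u z) ^ 2) := by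
        have : 0 ≤ p - k := by linarith
        positivity
      nlinarith [h3])
  have hsub := intervalIntegral.integral_sub hi2 (hi1.const_mul ((k * lam) ^ 2))
  simp only [Pi.mul_apply, Pi.pow_apply] at hsub
  rw [hsub, intervalIntegral.integral_const_mul] at key
  have h0 : 0 ≤ k * lam * (Real.exp (2 * lam / (R - z₀) ^ 2) * (u R) ^ 2) := by positivity
  linarith

/-- Integrated Carleman inequality in terms of the auxiliary function (inequality (3.9)):
with `y(z) = e^{λ(z-z₀)⁻²} w(z)`, there are `λ₀ > 1` and `C > 0` depending only on `R` and
`z₀` such that for all `λ ≥ λ₀`,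
`∫ e^{2λ(z-z₀)⁻²}|w''|² ≥ -C(λ³|y(R)|² + λ|y'(R)|²) - C(λ³|y(-R)|² + λ|y'(-R)|²)
  + Cλ³ ∫ |y|² - Cλ ∫ |y'|²`. -/
theorem carleman_integrated_aux (R z₀ : ℝ) (hR : 0 < R) (hz₀ : z₀ < -R) :
    ∃ lam₀ C : ℝ, 1 < lam₀ ∧ 0 < C ∧
      ∀ lam : ℝ, lam₀ ≤ lam →
      ∀ w w' w'' y y' : ℝ → ℝ,
        (∀ z ∈ Set.Icc (-R) R, HasDerivWithinAt w (w' z) (Set.Icc (-R) R) z) →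
        (∀ z ∈ Set.Icc (-R) R, HasDerivWithinAt w' (w'' z) (Set.Icc (-R) R) z) →
        ContinuousOn w'' (Set.Icc (-R) R) →
        (∀ z, y z = Real.exp (lam / (z - z₀) ^ 2) * w z) →
        (∀ z ∈ Set.Icc (-R) R, HasDerivWithinAt y (y' z) (Set.Icc (-R) R) z) →
        (∫ z in (-R)..R, Real.exp (2 * lam / (z - z₀) ^ 2) * (w'' z) ^ 2) ≥
          -C * (lam ^ 3 * (y R) ^ 2 + lam * (y' R) ^ 2)
          - C * (lam ^ 3 * (y (-R)) ^ 2 + lam * (y' (-R)) ^ 2)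
          + C * lam ^ 3 * (∫ z in (-R)..R, (y z) ^ 2)
          - C * lam * ∫ z in (-R)..R, (y' z) ^ 2 := by
  have hB : 0 < R - z₀ := by linarith
  have ha : 0 < -R - z₀ := by linarith
  obtain ⟨k, hk2⟩ : ∃ k, k = 2 / (R - z₀) ^ 3 := ⟨_, rfl⟩
  obtain ⟨P, hP⟩ : ∃ P, P = 2 / (-R - z₀) ^ 3 := ⟨_, rfl⟩
  have hk : 0 < k := by rw [hk2]; positivity
  obtain ⟨C, hC⟩ : ∃ C, C = k ^ 3 + 2 * k * P ^ 2 + 2 * k := ⟨_, rfl⟩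
  have hC0 : 0 < C := by rw [hC]; positivity
  refine ⟨C / k ^ 4 + 2, C, ?_, hC0, ?_⟩
  · have : 0 < C / k ^ 4 := by positivity
    linarith
  intro lam hlam w w' w'' y y' hw hw' hw'' hy hy'
  have hq : 0 < C / k ^ 4 := by positivity
  have hl : 0 < lam := by linarith
  have hlC : C ≤ lam * k ^ 4 := by
    rw [← div_le_iff₀ (by positivity)]; linarith
  have hw'c : ContinuousOn w' (Set.Icc (-R) R) := fun z hz => (hw' z hz).continuousWithinAt
  have s1 := carl_step R z₀ lam k hR hz₀ hl hk hk2 w w' hw hw'c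
  have s2 := carl_step R z₀ lam k hR hz₀ hl hk hk2 w' w'' hw' hw''
  have hE2 : ∀ z, Real.exp (2 * lam / (z - z₀) ^ 2) = Real.exp (lam / (z - z₀) ^ 2) ^ 2 := by
    intro z
    rw [← Real.exp_nat_mul]
    congr 1
    push_cast
    ring
  have hyy : ∀ z, Real.exp (2 * lam / (z - z₀) ^ 2) * (w z) ^ 2 = (y z) ^ 2 := by
    intro z
    rw [hy, hE2]; ring
  simp only [hyy] at s1
  have hmem : -R ∈ Set.Icc (-R) R := ⟨le_refl _, by linarith⟩
  have hd : y' (-R) = Real.exp (lam / (-R - z₀) ^ 2) * w' (-R) - P * lam * y (-R) := by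
    have h1 := ((carl_hasDeriv lam z₀ (-R) ha).hasDerivWithinAt (s := Set.Icc (-R) R)).mul
      (hw (-R) hmem)
    have hfy : y = (fun z => Real.exp (lam / (z - z₀) ^ 2)) * w := by
      funext z; simp [hy]
    rw [← hfy] at h1
    have h2 := (uniqueDiffOn_Icc (by linarith : -R < R) (-R) hmem).eq_deriv _ (hy' _ hmem) h1
    rw [h2, hy, hP]
    ring
  have hg : Real.exp (2 * lam / (-R - z₀) ^ 2) * (w' (-R)) ^ 2
      = (y' (-R) + P * lam * y (-R)) ^ 2 := by
    rw [hE2, hd]; ring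
  rw [hg] at s2
  have hI1 : 0 ≤ ∫ z in (-R)..R, (y z) ^ 2 :=
    intervalIntegral.integral_nonneg (by linarith) fun z _ => sq_nonneg _
  have hI2 : 0 ≤ ∫ z in (-R)..R, (y' z) ^ 2 :=
    intervalIntegral.integral_nonneg (by linarith) fun z _ => sq_nonneg _
  generalize (∫ z in (-R)..R, (y z) ^ 2) = I1 at *
  generalize (∫ z in (-R)..R, (y' z) ^ 2) = I2 at *
  generalize (∫ z in (-R)..R, Real.exp (2 * lam / (z - z₀) ^ 2) * (w' z) ^ 2) = G at *
  generalize (∫ z in (-R)..R, Real.exp (2 * lam / (z - z₀) ^ 2) * (w'' z) ^ 2) = F at *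
  generalize y' (-R) = b at *
  generalize y (-R) = a at *
  have t1 : (k * lam) ^ 2 * ((k * lam) ^ 2 * I1 - k * lam * a ^ 2) ≤ (k * lam) ^ 2 * G :=
    mul_le_mul_of_nonneg_left s1 (by positivity)
  have t2 : C * (lam ^ 3 * I1) ≤ lam * k ^ 4 * (lam ^ 3 * I1) :=
    mul_le_mul_of_nonneg_right hlC (by positivity)
  have t3 : 0 ≤ C * (lam ^ 3 * (y R) ^ 2 + lam * (y' R) ^ 2) := by positivity
  have t4 : 0 ≤ C * lam * I2 := by positivity
  have t5 : 0 ≤ k * lam * (b - P * lam * a) ^ 2 := by positivity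
  have t6 : k * lam * (b + P * lam * a) ^ 2 + k ^ 3 * lam ^ 3 * a ^ 2
      ≤ C * (lam ^ 3 * a ^ 2 + lam * b ^ 2) := by
    have e1 : 0 ≤ 2 * k * (lam ^ 3 * a ^ 2) := by positivity
    have e2 : 0 ≤ (k ^ 3 + 2 * k * P ^ 2) * (lam * b ^ 2) := by positivity
    rw [hC]
    nlinarith [t5, e1, e2]
  linarith
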